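/- For every prime p, g_{(5,1,2,1)}(p) = 7p^4 − p^3 − 2p^2, where (5,1,2,1) is the composition of 9 into 4 positive parts with entries 5, 1, 2, 1 in that order (so the corresponding irreducible subring matrices have size n = 5). -/

import Mathlib

/-- `v` lies in the ℤ-span of the columns of the square integer matrix `A`. -/
def InColSpan {n : ℕ} (A : Matrix (Fin n) (Fin n) ℤ) (v : Fin n → ℤ) : Prop :=
  ∃ x : Fin n → ℤ, A.mulVec x = v

/-- `A` is a subring matrix: upper triangular in Hermite normal form (positive
diagonal, `0 ≤ A i j < A i i` for `i < j`), the all-ones vector lies in the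
ℤ-span of the columns, and the componentwise product of any two columns lies in
the ℤ-span of the columns. -/
def IsSubringMatrix {n : ℕ} (A : Matrix (Fin n) (Fin n) ℤ) : Prop :=
  (∀ i j : Fin n, j < i → A i j = 0) ∧
  (∀ i : Fin n, 0 < A i i) ∧
  (∀ i j : Fin n, i < j → 0 ≤ A i j ∧ A i j < A i i) ∧
  InColSpan A (fun _ => 1) ∧
  (∀ j k : Fin n, InColSpan A (fun i => A i j * A i k))

/-- `A` is an irreducible subring matrix for the prime `p` with diagonal
`(p ^ α 0, …, p ^ α (n-1), 1)`: a subring matrix with the prescribed diagonal,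
whose last column has all entries equal to `1`, and all of whose off-diagonal
entries away from the last column are divisible by `p`. -/
def IsIrreducibleSubringMatrix (p : ℕ) {n : ℕ} (α : Fin n → ℕ)
    (A : Matrix (Fin (n + 1)) (Fin (n + 1)) ℤ) : Prop :=
  IsSubringMatrix A ∧
  (∀ i : Fin n, A i.castSucc i.castSucc = (p : ℤ) ^ α i) ∧
  A (Fin.last n) (Fin.last n) = 1 ∧
  (∀ i : Fin (n + 1), A i (Fin.last n) = 1) ∧
  (∀ i j : Fin n, i < j → (p : ℤ) ∣ A i.castSucc j.castSucc)

/-- `gComp p α` : the number of irreducible subring matrices with diagonal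
`(p ^ α 0, …, p ^ α (n-1), 1)`. -/
noncomputable def gComp (p : ℕ) {n : ℕ} (α : Fin n → ℕ) : ℕ :=
  Nat.card {A : Matrix (Fin (n + 1)) (Fin (n + 1)) ℤ // IsIrreducibleSubringMatrix p α A}

/-- `gNum p n e` : the number of irreducible subring matrices of size `n` with
determinant `p ^ e` (so `gNum p 1 0 = 1` and `gNum p 1 e = 0` for `e ≥ 1`). -/
noncomputable def gNum (p : ℕ) : ℕ → ℕ → ℕ
  | 0, _ => 0
  | m + 1, e =>
      Nat.card {A : Matrix (Fin (m + 1)) (Fin (m + 1)) ℤ //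
        (∃ α : Fin m → ℕ, (∀ i, 1 ≤ α i) ∧ IsIrreducibleSubringMatrix p α A) ∧
        A.det = (p : ℤ) ^ e}

/-- The solutions of `x ≡ r [ZMOD p ^ k]` in `[0, p ^ 4)`. -/
noncomputable def residueSolutions (p : ℕ) (k : ℕ) (r : ℤ) : Finset ℤ :=
  {x ∈ Finset.Ico (0 : ℤ) ((p : ℤ) ^ 4) | (p : ℤ) ^ k ∣ x - r}

/-- The conditions on the entries for the span of the columns of `matrix5121 p d a b c` to be
closed under multiplication. -/
def MulClosed (p d a b c : ℤ) : Prop :=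
  p ^ 3 ∣ a * (a - 1) ∧ p ^ 3 ∣ b * (b - p) ∧ p ^ 3 ∣ a * b ∧ p ^ 3 ∣ a * c ∧
    p ^ 3 ∣ b * (c - d) ∧ p ^ 4 ∣ p * (c * (c - 1)) - d * (d - 1) * b

/-- The general matrix in Hermite normal form with diagonal `(p ^ 5, p, p ^ 2, p, 1)`, last column
one and off-diagonal entries outside the last column divisible by `p`. -/
def matrix5121 (p d a b c : ℤ) : Matrix (Fin 5) (Fin 5) ℤ :=
  !![p ^ 5, p * a, p * b, p * c, 1;
     0, p, 0, 0, 1;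
     0, 0, p ^ 2, p * d, 1;
     0, 0, 0, p, 1;
     0, 0, 0, 0, 1]

open Classical in
/-- The triples `(a, b, c)` of reduced entries satisfying `MulClosed p d a b c`. -/
noncomputable def mulClosedTriples (p : ℕ) (d : ℤ) : Finset (ℤ × ℤ × ℤ) :=
  {t ∈ Finset.Ico (0 : ℤ) ((p : ℤ) ^ 4) ×ˢ Finset.Ico (0 : ℤ) ((p : ℤ) ^ 4) ×ˢ
    Finset.Ico (0 : ℤ) ((p : ℤ) ^ 4) | MulClosed p d t.1 t.2.1 t.2.2}

theorem mem_residueSolutions {p k : ℕ} {r x : ℤ} :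
    x ∈ residueSolutions p k r ↔ x ∈ Finset.Ico (0 : ℤ) ((p : ℤ) ^ 4) ∧ (p : ℤ) ^ k ∣ x - r := by
  simp [residueSolutions]

theorem card_residueSolutions {p : ℕ} (hp : p.Prime) {k m : ℕ} (hkm : k + m = 4) (r : ℤ) :
    (residueSolutions p k r).card = p ^ m := by
  have hp0 : (0 : ℤ) < p := by exact_mod_cast hp.pos
  have hpk : (0 : ℤ) < (p : ℤ) ^ k := by positivity
  have h := Int.Ico_filter_modEq_card 0 ((p : ℤ) ^ 4) hpk r
  have he : residueSolutions p k r
      = {x ∈ Finset.Ico (0 : ℤ) ((p : ℤ) ^ 4) | x ≡ r [ZMOD (p : ℤ) ^ k]} := by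
    ext x
    rw [mem_residueSolutions, Finset.mem_filter, Int.modEq_iff_dvd, dvd_sub_comm]
  rw [← he] at h
  have hq : (((p : ℤ) ^ 4 : ℤ) - r : ℚ) / ((p : ℤ) ^ k : ℤ)
      = ((0 : ℤ) - r : ℚ) / ((p : ℤ) ^ k : ℤ) + ((p ^ m : ℕ) : ℤ) := by
    have : (p : ℚ) ≠ 0 := by exact_mod_cast hp.ne_zero
    rw [← hkm]
    push_cast
    field_simp
    ring
  rw [hq, Int.ceil_add_intCast, add_sub_cancel_left, max_eq_left (by positivity)] at h
  exact_mod_cast h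

section Prime

variable {p : ℤ}

theorem pow_dvd_or_pow_dvd_sub {k : ℕ} (hp : Prime p) {x r y : ℤ} (hr : ¬ p ∣ r)
    (h : p ^ k ∣ x * (x - r) * y) : p ^ k ∣ x * y ∨ p ^ k ∣ (x - r) * y := by
  by_cases hx : p ∣ x
  · have : ¬ p ∣ x - r := fun h' => hr (by simpa using dvd_sub hx h')
    left
    exact hp.pow_dvd_of_dvd_mul_left k this (h.trans (dvd_of_eq (by ring)))
  · right
    exact hp.pow_dvd_of_dvd_mul_left k hx (h.trans (dvd_of_eq (by ring)))

theorem pow_dvd_or_pow_dvd_sub_one {k : ℕ} (hp : Prime p) {x : ℤ}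
    (h : p ^ k ∣ x * (x - 1)) : p ^ k ∣ x ∨ p ^ k ∣ x - 1 := by
  have := pow_dvd_or_pow_dvd_sub (y := 1) (k := k) hp hp.not_dvd_one (by simpa using h)
  simpa using this

theorem not_dvd_of_dvd_sub_one (hp : Prime p) {x : ℤ} (h : p ∣ x - 1) : ¬ p ∣ x := fun h' =>
  hp.not_dvd_one (by simpa using dvd_sub h' h)

theorem mulClosed_iff_of_mul_sub_one_eq_zero (hp : Prime p) {d a b c : ℤ} (hd : d = 0 ∨ d = 1) :
    MulClosed p d a b c ↔
      (p ^ 3 ∣ a - 1 ∧ p ^ 3 ∣ b ∧ p ^ 3 ∣ c) ∨ (p ^ 3 ∣ a ∧ p ^ 2 ∣ b - p ∧ p ^ 3 ∣ c - d) ∨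
      (p ^ 3 ∣ a ∧ p ^ 2 ∣ b ∧ p ^ 3 ∣ c - d) ∨ (p ^ 3 ∣ a ∧ p ^ 3 ∣ b ∧ p ^ 3 ∣ c - (1 - d)) := by
  have hdd : d * (d - 1) = 0 := by rcases hd with rfl | rfl <;> simp
  have hp3 : p ∣ p ^ 3 := dvd_pow_self p (by norm_num)
  have hp4 : ∀ x : ℤ, p ^ 4 ∣ p * x ↔ p ^ 3 ∣ x := fun x => by
    rw [pow_succ' p 3, mul_dvd_mul_iff_left hp.ne_zero]
  unfold MulClosed
  rw [hdd, zero_mul, sub_zero, hp4]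
  constructor
  · rintro ⟨h1, h2, h3, h4, h5, h6⟩
    rcases pow_dvd_or_pow_dvd_sub_one hp h1 with ha | ha
    · right
      have hc : p ^ 3 ∣ c - d ∨ p ^ 3 ∣ c - (1 - d) := by
        have := pow_dvd_or_pow_dvd_sub_one hp h6
        rcases hd with rfl | rfl
        · simpa using this
        · simpa using this.symm
      rcases hc with hc | hc
      · obtain ⟨b', rfl⟩ : p ∣ b := by
          rcases hp.dvd_or_dvd (hp3.trans h2) with h | h
          · exact h
          · exact (dvd_sub_self_right).1 h
        have : p ^ 1 ∣ b' * (b' - 1) := by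
          rw [show p * b' * (p * b' - p) = p ^ 2 * (b' * (b' - 1)) by ring, pow_succ p 2,
            mul_dvd_mul_iff_left (pow_ne_zero 2 hp.ne_zero)] at h2
          simpa using h2
        have hm : ∀ x, p ^ 1 ∣ x → p ^ 2 ∣ p * x := fun x hx => by
          rw [pow_succ' p 1]; exact mul_dvd_mul_left p hx
        rcases pow_dvd_or_pow_dvd_sub_one hp this with h | h
        · exact Or.inr (Or.inl ⟨ha, hm _ h, hc⟩)
        · refine Or.inl ⟨ha, ?_, hc⟩
          rw [show p * b' - p = p * (b' - 1) by ring]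
          exact hm _ h
      · have hcd : ¬ p ∣ c - d := by
          intro h
          have := dvd_sub h (hp3.trans hc)
          rcases hd with rfl | rfl
          · exact hp.not_dvd_one (by simpa using this)
          · exact hp.not_dvd_one (by simpa using this)
        exact Or.inr (Or.inr ⟨ha, hp.pow_dvd_of_dvd_mul_right 3 hcd h5, hc⟩)
    · left
      have ha' := not_dvd_of_dvd_sub_one hp (hp3.trans ha)
      exact ⟨ha, hp.pow_dvd_of_dvd_mul_left 3 ha' h3, hp.pow_dvd_of_dvd_mul_left 3 ha' h4⟩
  · have hc1 : p ^ 3 ∣ c - d ∨ p ^ 3 ∣ c - (1 - d) → p ^ 3 ∣ c * (c - 1) := by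
      rintro (h | h) <;> rcases hd with rfl | rfl
      · exact Dvd.dvd.mul_right (by simpa using h) _
      · exact h.mul_left _
      · exact Dvd.dvd.mul_left (by simpa using h) _
      · exact Dvd.dvd.mul_right (by simpa using h) _
    rintro (⟨ha, hb, hc⟩ | ⟨ha, hb, hc⟩ | ⟨ha, hb, hc⟩ | ⟨ha, hb, hc⟩)
    · exact ⟨ha.mul_left _, hb.mul_right _, hb.mul_left _, hc.mul_left _, hb.mul_right _,
        hc.mul_right _⟩
    · have hpb : p ∣ b := (dvd_sub_self_right).1 ((dvd_pow_self p two_ne_zero).trans hb)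
      exact ⟨ha.mul_right _, by rw [pow_succ']; exact mul_dvd_mul hpb hb, ha.mul_right _,
        ha.mul_right _, hc.mul_left _, hc1 (Or.inl hc)⟩
    · have hpb : p ∣ b := (dvd_pow_self p two_ne_zero).trans hb
      exact ⟨ha.mul_right _, by rw [pow_succ]; exact mul_dvd_mul hb (dvd_sub_self_right.2 hpb),
        ha.mul_right _, ha.mul_right _, hc.mul_left _, hc1 (Or.inl hc)⟩
    · exact ⟨ha.mul_right _, hb.mul_right _, ha.mul_right _, ha.mul_right _, hb.mul_right _,
        hc1 (Or.inr hc)⟩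

theorem mulClosed_iff_of_isUnit (hp : Prime p) {d a b c u : ℤ} (hd : ¬ p ∣ d) (hd1 : ¬ p ∣ d - 1)
    (hu : p ^ 4 ∣ u * (d * (d - 1)) - 1) :
    MulClosed p d a b c ↔ (p ^ 3 ∣ a - 1 ∧ p ^ 4 ∣ b ∧ p ^ 3 ∣ c) ∨
      (p ^ 3 ∣ a ∧ (p ^ 2 ∣ c ∨ p ^ 2 ∣ c - 1 ∨ p ^ 2 ∣ c - d) ∧
        p ^ 4 ∣ b - p * (u * (c * (c - 1)))) := by
  have hp3 : p ∣ p ^ 3 := dvd_pow_self p (by norm_num)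
  have hpu : ¬ p ∣ u := by
    have := not_dvd_of_dvd_sub_one hp ((dvd_pow_self p four_ne_zero).trans hu)
    exact fun h => this (h.mul_right _)
  have h34 : p ^ 3 ∣ p ^ 4 := pow_dvd_pow p (by norm_num)
  have hb_iff : p ^ 4 ∣ p * (c * (c - 1)) - d * (d - 1) * b ↔
      p ^ 4 ∣ b - p * (u * (c * (c - 1))) := by
    constructor
    · intro h
      have := dvd_sub ((h.mul_left u).neg_right) (hu.mul_right b)
      exact this.trans (dvd_of_eq (by ring))
    · intro h
      have := dvd_add (h.mul_left (-(d * (d - 1)))) ((hu.mul_right (-(p * (c * (c - 1))))))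
      exact this.trans (dvd_of_eq (by ring))
  unfold MulClosed
  rw [hb_iff]
  constructor
  · rintro ⟨h1, h2, h3, h4, h5, h6⟩
    rcases pow_dvd_or_pow_dvd_sub_one hp h1 with ha | ha
    · refine Or.inr ⟨ha, ?_, h6⟩
      have h7 : p ^ 3 ∣ p * (u * (c * (c - 1) * (c - d))) := by
        have := dvd_sub h5 ((h34.trans h6).mul_right (c - d))
        exact this.trans (dvd_of_eq (by ring))
      rw [pow_succ' p 2, mul_dvd_mul_iff_left hp.ne_zero] at h7
      have h8 := hp.pow_dvd_of_dvd_mul_left 2 hpu h7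
      rcases pow_dvd_or_pow_dvd_sub hp hp.not_dvd_one h8 with h | h
      · have := pow_dvd_or_pow_dvd_sub (y := 1) (k := 2) hp hd (by simpa using h)
        simp only [mul_one] at this
        tauto
      · have := pow_dvd_or_pow_dvd_sub (x := c - 1) (y := 1) (k := 2) hp hd1 
          (h.trans (dvd_of_eq (by ring)))
        simp only [mul_one, sub_sub_sub_cancel_right] at this
        tauto
    · left
      have ha' := not_dvd_of_dvd_sub_one hp (hp3.trans ha)
      have hc := hp.pow_dvd_of_dvd_mul_left 3 ha' h4
      refine ⟨ha, ?_, hc⟩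
      have : p ^ 4 ∣ p * (u * (c * (c - 1))) := by
        rw [pow_succ']
        exact mul_dvd_mul_left p ((hc.mul_right _).mul_left _)
      simpa using dvd_add h6 this
  · rintro (⟨ha, hb, hc⟩ | ⟨ha, hc, hb⟩)
    · have hb3 := h34.trans hb
      refine ⟨ha.mul_left _, hb3.mul_right _, hb3.mul_left _, hc.mul_left _, hb3.mul_right _,
        dvd_sub hb ?_⟩
      rw [pow_succ']
      exact mul_dvd_mul_left p ((hc.mul_right _).mul_left _)
    · have hb3 := h34.trans hb
      have hw : p ^ 2 ∣ u * (c * (c - 1)) ∨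
          (p ^ 2 ∣ u * (c * (c - 1)) - 1 ∧ p ^ 2 ∣ c - d) := by
        rcases hc with hc | hc | hc
        · exact Or.inl ((hc.mul_right _).mul_left _)
        · exact Or.inl ((hc.mul_left _).mul_left _)
        · refine Or.inr ⟨?_, hc⟩
          have := dvd_add (hc.mul_right (u * (c + d - 1)))
            ((pow_dvd_pow p (by norm_num : 2 ≤ 4)).trans hu)
          exact this.trans (dvd_of_eq (by ring))
      generalize u * (c * (c - 1)) = w at hw hb hb3
      obtain ⟨e, he⟩ := hb3
      obtain rfl : b = p * w + p ^ 3 * e := by linarith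
      refine ⟨ha.mul_right _, ?_, ha.mul_right _, ha.mul_right _, ?_, hb⟩
      · have hww : p ^ 2 ∣ w * (w - 1) :=
          hw.elim (fun h => h.mul_right _) (fun h => h.1.mul_left _)
        obtain ⟨f, hf⟩ := hww
        refine ⟨p * f + e * (2 * p * w - p + p ^ 3 * e), ?_⟩
        linear_combination p ^ 2 * hf
      · have hwc : p ^ 2 ∣ w * (c - d) :=
          hw.elim (fun h => h.mul_right _) (fun h => h.2.mul_left _)
        obtain ⟨f, hf⟩ := hwc
        refine ⟨f + e * (c - d), ?_⟩
        linear_combination p * hf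

end Prime

theorem mem_mulClosedTriples {p : ℕ} {d a b c : ℤ} : (a, b, c) ∈ mulClosedTriples p d ↔
    (a ∈ Finset.Ico (0 : ℤ) ((p : ℤ) ^ 4) ∧ b ∈ Finset.Ico (0 : ℤ) ((p : ℤ) ^ 4) ∧
      c ∈ Finset.Ico (0 : ℤ) ((p : ℤ) ^ 4)) ∧ MulClosed p d a b c := by
  simp only [mulClosedTriples, Finset.mem_filter, Finset.mem_product]

theorem disjoint_residueSolutions {p k l : ℕ} {r s : ℤ} (hk : k ≠ 0) (hl : l ≠ 0)
    (h : ¬ (p : ℤ) ∣ r - s) : Disjoint (residueSolutions p k r) (residueSolutions p l s) := by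
  rw [Finset.disjoint_left]
  intro x hx hx'
  rw [mem_residueSolutions] at hx hx'
  apply h
  have := dvd_sub ((dvd_pow_self _ hl).trans hx'.2) ((dvd_pow_self _ hk).trans hx.2)
  exact this.trans (dvd_of_eq (by ring))

theorem card_mulClosedTriples_of_eq_zero_or_one {p : ℕ} (hp : p.Prime) {d : ℤ}
    (hd : d = 0 ∨ d = 1) : (mulClosedTriples p d).card = 2 * p ^ 4 + 2 * p ^ 3 := by
  have hp' : Prime (p : ℤ) := Nat.prime_iff_prime_int.1 hp
  have h1 : ¬ (p : ℤ) ∣ 1 := hp'.not_dvd_one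
  have heq : mulClosedTriples p d =
      (residueSolutions p 3 1 ×ˢ residueSolutions p 3 0 ×ˢ residueSolutions p 3 0) ∪
      residueSolutions p 3 0 ×ˢ
        ((residueSolutions p 2 p ∪ residueSolutions p 2 0) ×ˢ residueSolutions p 3 d ∪
          residueSolutions p 3 0 ×ˢ residueSolutions p 3 (1 - d)) := by
    ext ⟨a, b, c⟩
    rw [mem_mulClosedTriples, mulClosed_iff_of_mul_sub_one_eq_zero hp' hd]
    simp only [Finset.mem_union, Finset.mem_product, mem_residueSolutions, sub_zero]
    tauto
  have hdis : Disjoint (residueSolutions p 3 d) (residueSolutions p 3 (1 - d)) := by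
    apply disjoint_residueSolutions three_ne_zero three_ne_zero
    rcases hd with rfl | rfl <;> simpa using h1
  have hdis' : Disjoint (residueSolutions p 2 (p : ℤ)) (residueSolutions p 2 0) := by
    rw [Finset.disjoint_left]
    intro x hx hx'
    rw [mem_residueSolutions] at hx hx'
    have := dvd_sub hx'.2 hx.2
    rw [sub_zero, sub_sub_cancel, pow_two] at this
    nth_rewrite 3 [← mul_one (p : ℤ)] at this
    exact h1 ((mul_dvd_mul_iff_left hp'.ne_zero).1 this)
  rw [heq, Finset.card_union_of_disjoint, Finset.card_product, Finset.card_product,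
    Finset.card_product, Finset.card_union_of_disjoint, Finset.card_product,
    Finset.card_union_of_disjoint hdis', Finset.card_product]
  · simp only [card_residueSolutions hp (show 3 + 1 = 4 from rfl),
      card_residueSolutions hp (show 2 + 2 = 4 from rfl)]
    ring
  · exact Finset.disjoint_product.2 (Or.inr hdis)
  · exact Finset.disjoint_product.2
      (Or.inl (disjoint_residueSolutions three_ne_zero three_ne_zero (by simpa using h1)))

theorem card_mulClosedTriples_of_two_le {p : ℕ} (hp : p.Prime) {d : ℤ} (hd : 2 ≤ d)
    (hdp : d < p) : (mulClosedTriples p d).card = p ^ 2 + 3 * p ^ 3 := by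
  have hp' : Prime (p : ℤ) := Nat.prime_iff_prime_int.1 hp
  have h1 : ¬ (p : ℤ) ∣ 1 := hp'.not_dvd_one
  have hd0 : ¬ (p : ℤ) ∣ d := fun h => by linarith [Int.le_of_dvd (by linarith) h]
  have hd1 : ¬ (p : ℤ) ∣ d - 1 := fun h => by linarith [Int.le_of_dvd (by linarith) h]
  have hdd : ¬ (p : ℤ) ∣ d * (d - 1) := fun h => (hp'.dvd_or_dvd h).elim hd0 hd1
  obtain ⟨v, u, huv⟩ : IsCoprime ((p : ℤ) ^ 4) (d * (d - 1)) :=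
    ((hp'.coprime_iff_not_dvd).2 hdd).pow_left
  have hu : (p : ℤ) ^ 4 ∣ u * (d * (d - 1)) - 1 := ⟨-v, by linear_combination huv⟩
  have hp4 : (0 : ℤ) < (p : ℤ) ^ 4 := pow_pos (by exact_mod_cast hp.pos) 4
  set f : ℤ → ℤ × ℤ := fun c => (p * (u * (c * (c - 1))) % (p : ℤ) ^ 4, c) with hf
  have hf_inj : Function.Injective f := fun x y h => congrArg Prod.snd h
  have heq : mulClosedTriples p d =
      (residueSolutions p 3 1 ×ˢ residueSolutions p 4 0 ×ˢ residueSolutions p 3 0) ∪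
      residueSolutions p 3 0 ×ˢ ((residueSolutions p 2 0 ∪ residueSolutions p 2 1) ∪
        residueSolutions p 2 d).image f := by
    ext ⟨a, b, c⟩
    have hb : (b ∈ Finset.Ico (0 : ℤ) ((p : ℤ) ^ 4) ∧
        (p : ℤ) ^ 4 ∣ b - p * (u * (c * (c - 1)))) ↔
        p * (u * (c * (c - 1))) % (p : ℤ) ^ 4 = b := by
      rw [Finset.mem_Ico]
      constructor
      · rintro ⟨⟨h0, h2⟩, h⟩
        rw [(Int.modEq_iff_dvd.2 h).eq, Int.emod_eq_of_lt h0 h2]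
      · rintro rfl
        exact ⟨⟨Int.emod_nonneg _ hp4.ne', Int.emod_lt_of_pos _ hp4⟩,
          (Int.mod_modEq _ _).symm.dvd⟩
    have himage : ∀ s : Finset ℤ, (b, c) ∈ s.image f ↔
        c ∈ s ∧ p * (u * (c * (c - 1))) % (p : ℤ) ^ 4 = b := fun s => by
      simp only [hf, Finset.mem_image, Prod.mk.injEq]
      exact ⟨by rintro ⟨x, hx, h, rfl⟩; exact ⟨hx, h⟩, fun ⟨hc, h⟩ => ⟨c, hc, h, rfl⟩⟩
    rw [mem_mulClosedTriples, mulClosed_iff_of_isUnit hp' hd0 hd1 hu]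
    simp only [Finset.mem_union, Finset.mem_product, mem_residueSolutions, sub_zero, himage, ← hb]
    tauto
  rw [heq, Finset.card_union_of_disjoint, Finset.card_product, Finset.card_product,
    Finset.card_product, Finset.card_image_of_injective _ hf_inj, Finset.card_union_of_disjoint,
    Finset.card_union_of_disjoint]
  · simp only [card_residueSolutions hp (show 3 + 1 = 4 from rfl),
      card_residueSolutions hp (show 2 + 2 = 4 from rfl),
      card_residueSolutions hp (show 4 + 0 = 4 from rfl)]
    ring
  · exact disjoint_residueSolutions two_ne_zero two_ne_zero (by simpa using h1)
  · rw [Finset.disjoint_union_left]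
    exact ⟨disjoint_residueSolutions two_ne_zero two_ne_zero (by simpa using hd0),
      disjoint_residueSolutions two_ne_zero two_ne_zero (by rwa [dvd_sub_comm])⟩
  · exact Finset.disjoint_product.2
      (Or.inl (disjoint_residueSolutions three_ne_zero three_ne_zero (by simpa using h1)))

theorem sum_card_mulClosedTriples {p : ℕ} (hp : p.Prime) :
    ((∑ d ∈ Finset.Ico (0 : ℤ) p, (mulClosedTriples p d).card : ℕ) : ℤ) =
      7 * (p : ℤ) ^ 4 - (p : ℤ) ^ 3 - 2 * (p : ℤ) ^ 2 := by
  have hp2 : (2 : ℤ) ≤ p := by exact_mod_cast hp.two_le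
  have hsplit : Finset.Ico (0 : ℤ) p = {0, 1} ∪ Finset.Ico 2 (p : ℤ) := by
    ext x
    simp only [Finset.mem_union, Finset.mem_insert, Finset.mem_singleton, Finset.mem_Ico]
    omega
  rw [hsplit, Finset.sum_union, Finset.sum_pair zero_ne_one,
    card_mulClosedTriples_of_eq_zero_or_one hp (Or.inl rfl),
    card_mulClosedTriples_of_eq_zero_or_one hp (Or.inr rfl),
    Finset.sum_congr rfl fun d hd => card_mulClosedTriples_of_two_le hp (Finset.mem_Ico.1 hd).1
      (Finset.mem_Ico.1 hd).2]
  · simp only [Finset.sum_const, Int.card_Ico, smul_eq_mul]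
    push_cast
    rw [Int.toNat_of_nonneg (by linarith)]
    ring
  · rw [Finset.disjoint_left]
    intro x hx hx'
    simp only [Finset.mem_insert, Finset.mem_singleton, Finset.mem_Ico] at hx hx'
    omega

theorem inColSpan_matrix5121_iff {p d a b c v₀ v₁ v₂ v₃ v₄ : ℤ} :
    InColSpan (matrix5121 p d a b c) ![v₀, v₁, v₂, v₃, v₄] ↔
      ∃ x₀ x₁ x₂ x₃ : ℤ, p ^ 5 * x₀ + p * a * x₁ + p * b * x₂ + p * c * x₃ + v₄ = v₀ ∧
        p * x₁ + v₄ = v₁ ∧ p ^ 2 * x₂ + p * d * x₃ + v₄ = v₂ ∧ p * x₃ + v₄ = v₃ := by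
  constructor
  · rintro ⟨x, hx⟩
    refine ⟨x 0, x 1, x 2, x 3, ?_⟩
    have h0 := congrFun hx 0
    have h1 := congrFun hx 1
    have h2 := congrFun hx 2
    have h3 := congrFun hx 3
    have h4 := congrFun hx 4
    simp [matrix5121, Matrix.mulVec, dotProduct, Fin.sum_univ_five] at h0 h1 h2 h3 h4
    subst h4
    exact ⟨h0, h1, h2, h3⟩
  · rintro ⟨x₀, x₁, x₂, x₃, h0, h1, h2, h3⟩
    refine ⟨![x₀, x₁, x₂, x₃, v₄], ?_⟩
    ext i
    fin_cases i <;> simp [matrix5121, Matrix.mulVec, dotProduct, Fin.sum_univ_five] <;> assumption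

theorem inColSpan_matrix5121_iff_dvd {p d a b c v₀ : ℤ} (hp : p ≠ 0) (y₁ y₂ y₃ : ℤ)
    {v : Fin 5 → ℤ} (hv : v = ![v₀, p * y₁, p ^ 2 * y₂ + p * d * y₃, p * y₃, 0]) :
    InColSpan (matrix5121 p d a b c) v ↔
      p ^ 5 ∣ v₀ - (p * a * y₁ + p * b * y₂ + p * c * y₃) := by
  rw [hv, inColSpan_matrix5121_iff]
  constructor
  · rintro ⟨x₀, x₁, x₂, x₃, h0, h1, h2, h3⟩
    obtain rfl : x₁ = y₁ := mul_left_cancel₀ hp (by linarith)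
    obtain rfl : x₃ = y₃ := mul_left_cancel₀ hp (by linarith)
    obtain rfl : x₂ = y₂ := mul_left_cancel₀ (pow_ne_zero 2 hp) (by linarith)
    exact ⟨x₀, by linarith⟩
  · rintro ⟨x₀, h⟩
    exact ⟨x₀, y₁, y₂, y₃, by linarith, by ring, by ring, by ring⟩

theorem inColSpan_col {n : ℕ} (A : Matrix (Fin n) (Fin n) ℤ) (j : Fin n) :
    InColSpan A fun i => A i j :=
  ⟨Pi.single j 1, by ext i; simp⟩

theorem forall_inColSpan_mul_matrix5121_iff {p d a b c : ℤ} (hp : p ≠ 0) :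
    (∀ j k, InColSpan (matrix5121 p d a b c)
      (fun i => matrix5121 p d a b c i j * matrix5121 p d a b c i k)) ↔ MulClosed p d a b c := by
  have hvec : ∀ {v w : Fin 5 → ℤ}, v 0 = w 0 → v 1 = w 1 → v 2 = w 2 → v 3 = w 3 → v 4 = w 4 →
      v = w := fun h0 h1 h2 h3 h4 => by
    ext i
    fin_cases i <;> assumption
  have hp5 : ∀ x y : ℤ, y = p ^ 2 * x → (p ^ 5 ∣ y ↔ p ^ 3 ∣ x) := by
    rintro x _ rfl
    rw [show p ^ 5 = p ^ 2 * p ^ 3 by ring, mul_dvd_mul_iff_left (pow_ne_zero 2 hp)]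
  set A := matrix5121 p d a b c with hA
  have h11 : InColSpan A (fun i => A i 1 * A i 1) ↔ p ^ 3 ∣ a * (a - 1) :=
    (inColSpan_matrix5121_iff_dvd hp p 0 0 (v₀ := (p * a) * (p * a))
      (by apply hvec <;> simp [hA, matrix5121])).trans (hp5 _ _ (by ring))
  have h12 : InColSpan A (fun i => A i 1 * A i 2) ↔ p ^ 3 ∣ a * b :=
    (inColSpan_matrix5121_iff_dvd hp 0 0 0 (v₀ := (p * a) * (p * b))
      (by apply hvec <;> simp [hA, matrix5121])).trans (hp5 _ _ (by ring))
  have h13 : InColSpan A (fun i => A i 1 * A i 3) ↔ p ^ 3 ∣ a * c :=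
    (inColSpan_matrix5121_iff_dvd hp 0 0 0 (v₀ := (p * a) * (p * c))
      (by apply hvec <;> simp [hA, matrix5121])).trans (hp5 _ _ (by ring))
  have h22 : InColSpan A (fun i => A i 2 * A i 2) ↔ p ^ 3 ∣ b * (b - p) :=
    (inColSpan_matrix5121_iff_dvd hp 0 (p ^ 2) 0 (v₀ := (p * b) * (p * b))
      (by apply hvec <;> simp [hA, matrix5121])).trans (hp5 _ _ (by ring))
  have h23 : InColSpan A (fun i => A i 2 * A i 3) ↔ p ^ 3 ∣ b * (c - d) :=
    (inColSpan_matrix5121_iff_dvd hp 0 (p * d) 0 (v₀ := (p * b) * (p * c))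
      (by apply hvec <;> simp [hA, matrix5121])).trans (hp5 _ _ (by ring))
  have h33 : InColSpan A (fun i => A i 3 * A i 3) ↔
      p ^ 4 ∣ p * (c * (c - 1)) - d * (d - 1) * b := by
    refine (inColSpan_matrix5121_iff_dvd hp 0 (d * (d - 1)) p (v₀ := (p * c) * (p * c))
      (by apply hvec <;> simp [hA, matrix5121]; ring)).trans ?_
    rw [pow_succ' p 4, ← mul_dvd_mul_iff_left hp (c := p * (c * (c - 1)) - d * (d - 1) * b)]
    ring_nf
  have h0 : ∀ k, InColSpan A (fun i => A i 0 * A i k) := fun k =>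
    (inColSpan_matrix5121_iff_dvd hp 0 0 0 (v₀ := p ^ 5 * A 0 k)
      (by apply hvec <;> simp [hA, matrix5121])).2 (by simp)
  have h4 : ∀ j, InColSpan A (fun i => A i j * A i 4) := fun j => by
    convert inColSpan_col A j using 2 with i
    fin_cases i <;> simp [hA, matrix5121]
  unfold MulClosed
  rw [← h11, ← h22, ← h12, ← h13, ← h23, ← h33]
  constructor
  · exact fun h => ⟨h 1 1, h 2 2, h 1 2, h 1 3, h 2 3, h 3 3⟩
  · rintro ⟨h11, h22, h12, h13, h23, h33⟩ j k
    wlog hjk : j ≤ k generalizing j k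
    · simpa only [mul_comm] using this k j (le_of_not_ge hjk)
    fin_cases j <;> fin_cases k <;> first
      | exact absurd hjk (by decide)
      | exact h0 _
      | exact h4 _
      | assumption

theorem isIrreducibleSubringMatrix_matrix5121_iff {p : ℕ} (hp : p.Prime) {d a b c : ℤ} :
    IsIrreducibleSubringMatrix p ![5, 1, 2, 1] (matrix5121 p d a b c) ↔
      d ∈ Finset.Ico (0 : ℤ) p ∧ (a, b, c) ∈ mulClosedTriples p d := by
  have hp0 : (0 : ℤ) < p := by exact_mod_cast hp.pos
  have hbound : ∀ (k : ℕ) (x : ℤ), x ∈ Finset.Ico (0 : ℤ) ((p : ℤ) ^ k) ↔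
      0 ≤ p * x ∧ p * x < (p : ℤ) ^ (k + 1) := fun k x => by
    rw [pow_succ', mul_lt_mul_iff_right₀ hp0, mul_nonneg_iff_of_pos_left hp0, Finset.mem_Ico]
  have hd : d ∈ Finset.Ico (0 : ℤ) p ↔ 0 ≤ p * d ∧ p * d < (p : ℤ) ^ 2 := by
    simpa using hbound 1 d
  rw [mem_mulClosedTriples, hd, hbound, hbound, hbound,
    ← forall_inColSpan_mul_matrix5121_iff hp0.ne']
  constructor
  · rintro ⟨⟨-, -, h, -, hmul⟩, -⟩
    exact ⟨h 2 3 (by decide), ⟨h 0 1 (by decide), h 0 2 (by decide), h 0 3 (by decide)⟩, hmul⟩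
  · rintro ⟨hd, ⟨ha, hb, hc⟩, hmul⟩
    refine ⟨⟨?_, ?_, ?_, ?_, hmul⟩, ?_, rfl, ?_, ?_⟩
    · intro i j hij
      fin_cases i <;> fin_cases j <;> first | rfl | exact absurd hij (by decide)
    · intro i
      have hpos := hp.pos
      fin_cases i <;> simp [matrix5121] <;> positivity
    · intro i j hij
      have hp1 : (1 : ℤ) < p := by exact_mod_cast hp.one_lt
      have hpow : ∀ k : ℕ, k ≠ 0 → 0 ≤ (1 : ℤ) ∧ 1 < (p : ℤ) ^ k := fun k hk =>
        ⟨zero_le_one, one_lt_pow₀ hp1 hk⟩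
      have hzero : 0 ≤ (0 : ℤ) ∧ 0 < (p : ℤ) := ⟨le_rfl, hp0⟩
      fin_cases i <;> fin_cases j <;> first
        | exact absurd hij (by decide)
        | assumption
        | exact hzero
        | exact ⟨zero_le_one, hp1⟩
        | exact hpow _ (by norm_num)
    · convert inColSpan_col (matrix5121 p d a b c) 4 using 2 with i
      fin_cases i <;> rfl
    · intro i
      fin_cases i <;> simp [matrix5121]
    · intro i
      fin_cases i <;> rfl
    · intro i j hij
      fin_cases i <;> fin_cases j <;> first
        | exact absurd hij (by decide)
        | exact dvd_zero _
        | exact dvd_mul_right _ _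

theorem exists_eq_matrix5121 {p : ℕ} {A : Matrix (Fin 5) (Fin 5) ℤ}
    (hA : IsIrreducibleSubringMatrix p ![5, 1, 2, 1] A) :
    ∃ d a b c : ℤ, matrix5121 p d a b c = A := by
  obtain ⟨⟨hlow, -, hlt, -, -⟩, hdiag, -, hlast, hdvd⟩ := hA
  obtain ⟨a, ha⟩ : (p : ℤ) ∣ A 0 1 := hdvd 0 1 (by decide)
  obtain ⟨b, hb⟩ : (p : ℤ) ∣ A 0 2 := hdvd 0 2 (by decide)
  obtain ⟨c, hc⟩ : (p : ℤ) ∣ A 0 3 := hdvd 0 3 (by decide)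
  obtain ⟨d, hd⟩ : (p : ℤ) ∣ A 2 3 := hdvd 2 3 (by decide)
  have h00 : A 0 0 = (p : ℤ) ^ 5 := hdiag 0
  have h11 : A 1 1 = (p : ℤ) := (hdiag 1).trans (pow_one _)
  have h22 : A 2 2 = (p : ℤ) ^ 2 := hdiag 2
  have h33 : A 3 3 = (p : ℤ) := (hdiag 3).trans (pow_one _)
  have h12 : A 1 2 = 0 := Int.eq_zero_of_dvd_of_nonneg_of_lt (hlt 1 2 (by decide)).1
    ((hlt 1 2 (by decide)).2.trans_eq h11) (hdvd 1 2 (by decide))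
  have h13 : A 1 3 = 0 := Int.eq_zero_of_dvd_of_nonneg_of_lt (hlt 1 3 (by decide)).1
    ((hlt 1 3 (by decide)).2.trans_eq h11) (hdvd 1 3 (by decide))
  refine ⟨d, a, b, c, ?_⟩
  ext i j
  fin_cases i <;> fin_cases j <;> symm <;> first
    | exact hlow _ _ (by decide)
    | exact hlast _
    | assumption

theorem matrix5121_injective {p : ℤ} (hp : p ≠ 0) : Function.Injective
    fun t : Σ _ : ℤ, ℤ × ℤ × ℤ => matrix5121 p t.1 t.2.1 t.2.2.1 t.2.2.2 := by
  rintro ⟨d, a, b, c⟩ ⟨d', a', b', c'⟩ h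
  obtain rfl : d = d' := mul_left_cancel₀ hp (congrFun (congrFun h 2) 3)
  obtain rfl : a = a' := mul_left_cancel₀ hp (congrFun (congrFun h 0) 1)
  obtain rfl : b = b' := mul_left_cancel₀ hp (congrFun (congrFun h 0) 2)
  obtain rfl : c = c' := mul_left_cancel₀ hp (congrFun (congrFun h 0) 3)
  rfl

theorem gComp_eq_sum_card_mulClosedTriples {p : ℕ} (hp : p.Prime) :
    gComp p ![5, 1, 2, 1] = ∑ d ∈ Finset.Ico (0 : ℤ) p, (mulClosedTriples p d).card := by
  have hp0 : (p : ℤ) ≠ 0 := by exact_mod_cast hp.ne_zero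
  have himage : {A : Matrix (Fin 5) (Fin 5) ℤ | IsIrreducibleSubringMatrix p ![5, 1, 2, 1] A} =
      (fun t : Σ _ : ℤ, ℤ × ℤ × ℤ => matrix5121 p t.1 t.2.1 t.2.2.1 t.2.2.2) ''
        ((Finset.Ico (0 : ℤ) p).sigma (mulClosedTriples p) : Finset (Σ _ : ℤ, ℤ × ℤ × ℤ)) := by
    ext A
    constructor
    · intro hA
      obtain ⟨d, a, b, c, rfl⟩ := exists_eq_matrix5121 hA
      exact ⟨⟨d, a, b, c⟩,
        Finset.mem_coe.2 (Finset.mem_sigma.2 ((isIrreducibleSubringMatrix_matrix5121_iff hp).1 hA)), rfl⟩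
    · rintro ⟨⟨d, a, b, c⟩, ht, rfl⟩
      exact (isIrreducibleSubringMatrix_matrix5121_iff hp).2 (Finset.mem_sigma.1 (Finset.mem_coe.1 ht))
  rw [← Finset.card_sigma, ← Set.ncard_coe_finset,
    ← Set.ncard_image_of_injective _ (matrix5121_injective hp0), ← himage]
  rfl

theorem g_5121 (p : ℕ) (hp : p.Prime) :
    (gComp p ![5, 1, 2, 1] : ℤ) =
      7 * (p : ℤ) ^ 4 - (p : ℤ) ^ 3 - 2 * (p : ℤ) ^ 2 := by
  rw [gComp_eq_sum_card_mulClosedTriples hp, sum_card_mulClosedTriples hp]
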